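/- Let p be an odd prime and let M be a vertex-transitive equivelar map of Schläfli type {3,7} with Euler characteristic χ(M) = −p. Then M is regular. -/

import Mathlib

/-- A map: a finite nonempty set of flags with three fixed-point-free involutions
`s0, s1, s2` such that `s0 * s2` is also a fixed-point-free involution and the
group generated by them acts transitively on the flags. -/
structure CMap (F : Type) [Fintype F] where
  nonempty : Nonempty F
  s0 : Equiv.Perm F
  s1 : Equiv.Perm F
  s2 : Equiv.Perm F
  invol0 : s0 * s0 = 1
  invol1 : s1 * s1 = 1
  invol2 : s2 * s2 = 1
  fpf0 : ∀ x, s0 x ≠ x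
  fpf1 : ∀ x, s1 x ≠ x
  fpf2 : ∀ x, s2 x ≠ x
  invol02 : (s0 * s2) * (s0 * s2) = 1
  fpf02 : ∀ x, s0 (s2 x) ≠ x
  conn : ∀ x y : F, ∃ g ∈ Subgroup.closure ({s0, s1, s2} : Set (Equiv.Perm F)), g x = y

namespace CMap

variable {F : Type} [Fintype F]

/-- The automorphism group of a map: all permutations of the flags commuting
with each of `s0, s1, s2`. -/
def aut (M : CMap F) : Subgroup (Equiv.Perm F) :=
  Subgroup.centralizer {M.s0, M.s1, M.s2}

/-- The vertex containing a flag `x`: the orbit of `x` under `⟨s1, s2⟩`. -/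
def vertexOf (M : CMap F) (x : F) : Set F :=
  MulAction.orbit (Subgroup.closure ({M.s1, M.s2} : Set (Equiv.Perm F))) x

/-- The edge containing a flag `x`: the orbit of `x` under `⟨s0, s2⟩`. -/
def edgeOf (M : CMap F) (x : F) : Set F :=
  MulAction.orbit (Subgroup.closure ({M.s0, M.s2} : Set (Equiv.Perm F))) x

/-- The face containing a flag `x`: the orbit of `x` under `⟨s0, s1⟩`. -/
def faceOf (M : CMap F) (x : F) : Set F :=
  MulAction.orbit (Subgroup.closure ({M.s0, M.s1} : Set (Equiv.Perm F))) x

/-- The orbit of a flag under the automorphism group. -/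
def flagOrbit (M : CMap F) (x : F) : Set F :=
  MulAction.orbit M.aut x

noncomputable def numVertices (M : CMap F) : ℕ := Nat.card (Set.range M.vertexOf)

noncomputable def numEdges (M : CMap F) : ℕ := Nat.card (Set.range M.edgeOf)

noncomputable def numFaces (M : CMap F) : ℕ := Nat.card (Set.range M.faceOf)

/-- The Euler characteristic `V - E + F` of a map. -/
noncomputable def euler (M : CMap F) : ℤ :=
  (M.numVertices : ℤ) - (M.numEdges : ℤ) + (M.numFaces : ℤ)

/-- The number of orbits of the automorphism group on flags. -/
noncomputable def numFlagOrbits (M : CMap F) : ℕ := Nat.card (Set.range M.flagOrbit)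

/-- `M` is a `k`-orbit map if its automorphism group has exactly `k` orbits on flags. -/
def IsKOrbit (M : CMap F) (k : ℕ) : Prop := M.numFlagOrbits = k

/-- A map is regular if it is a 1-orbit map. -/
def IsRegular (M : CMap F) : Prop := M.IsKOrbit 1

/-- A map is chiral if it is a 2-orbit map in which every flag lies in a
different automorphism orbit from each of its images under `s0, s1, s2`. -/
def IsChiral (M : CMap F) : Prop :=
  M.IsKOrbit 2 ∧ ∀ x : F,
    M.s0 x ∉ M.flagOrbit x ∧ M.s1 x ∉ M.flagOrbit x ∧ M.s2 x ∉ M.flagOrbit x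

/-- A map is vertex-transitive if its automorphism group acts transitively on vertices. -/
def VertexTransitive (M : CMap F) : Prop :=
  ∀ x y : F, ∃ g ∈ M.aut, M.vertexOf (g x) = M.vertexOf y

/-- A map is edge-transitive if its automorphism group acts transitively on edges. -/
def EdgeTransitive (M : CMap F) : Prop :=
  ∀ x y : F, ∃ g ∈ M.aut, M.edgeOf (g x) = M.edgeOf y

/-- `M` is equivelar of Schläfli type `{p, q}`: every face has exactly `2p` flags
and every vertex has exactly `2q` flags. -/
def Equivelar (M : CMap F) (p q : ℕ) : Prop :=
  (∀ x : F, Nat.card (M.faceOf x) = 2 * p) ∧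
  (∀ x : F, Nat.card (M.vertexOf x) = 2 * q)

/-- A map is orientable if the flags can be partitioned into two classes so that
each of `s0, s1, s2` maps each class into the other. -/
def Orientable (M : CMap F) : Prop :=
  ∃ A : Set F,
    (∀ x, M.s0 x ∈ A ↔ x ∉ A) ∧ (∀ x, M.s1 x ∈ A ↔ x ∉ A) ∧ (∀ x, M.s2 x ∈ A ↔ x ∉ A)

end CMap

/-- Two maps are isomorphic if there is a bijection between their flag sets
commuting with the respective involutions. -/
def CMap.Isomorphic {F F' : Type} [Fintype F] [Fintype F'] (M : CMap F) (N : CMap F') : Prop :=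
  ∃ e : F ≃ F',
    (∀ x, e (M.s0 x) = N.s0 (e x)) ∧ (∀ x, e (M.s1 x) = N.s1 (e x)) ∧
    (∀ x, e (M.s2 x) = N.s2 (e x))

section Counting

open Classical in
/-- If `f` assigns to every point of `S` a block of size `n` so that the blocks partition `S`,
then `S` has `n` times as many points as there are blocks. -/
theorem card_eq_card_blocks_mul {F : Type} [Fintype F] (S : Finset F) (f : F → Set F) (n : ℕ)
    (hmem : ∀ x ∈ S, x ∈ f x) (hblock : ∀ x ∈ S, ∀ y ∈ f x, y ∈ S ∧ f y = f x)
    (hcard : ∀ x ∈ S, (f x).ncard = n) : S.card = (S.image f).card * n := by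
  rw [Finset.card_eq_sum_card_image f S, Finset.sum_const_nat]
  intro b hb
  obtain ⟨x, hx, rfl⟩ := Finset.mem_image.1 hb
  rw [← hcard x hx, ← Set.ncard_coe_finset]
  congr 1
  ext y
  simp only [Finset.coe_filter, Set.mem_ofPred_eq]
  exact ⟨fun h => h.2 ▸ hmem y h.1, fun h => hblock x hx y h⟩

/-- A finite set with a free action of the Klein four-group has cardinality divisible by four. -/
theorem four_dvd_card_of_free {F : Type} [Fintype F] (S : Finset F) (a b : Equiv.Perm F)
    (ha : a * a = 1) (hb : b * b = 1) (hab : a * b = b * a)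
    (hSa : ∀ x ∈ S, a x ∈ S) (hSb : ∀ x ∈ S, b x ∈ S)
    (hfa : ∀ x, a x ≠ x) (hfb : ∀ x, b x ≠ x) (hfab : ∀ x ∈ S, a x ≠ b x) : 4 ∣ S.card := by
  have ha' : ∀ x, a (a x) = x := fun x => Equiv.congr_fun ha x
  have hb' : ∀ x, b (b x) = x := fun x => Equiv.congr_fun hb x
  have hab' : ∀ x, a (b x) = b (a x) := fun x => Equiv.congr_fun hab x
  rw [card_eq_card_blocks_mul S (fun x => {x, a x, b x, a (b x)}) 4]
  · exact dvd_mul_left _ _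
  · simp
  · intro x hx y hy
    simp only [Set.mem_insert_iff, Set.mem_singleton_iff] at hy
    rcases hy with rfl | rfl | rfl | rfl
    · exact ⟨hx, rfl⟩
    · refine ⟨hSa _ hx, ?_⟩
      ext z
      simp only [Set.mem_insert_iff, Set.mem_singleton_iff, ha', ← hab']
      tauto
    · refine ⟨hSb _ hx, ?_⟩
      ext z
      simp only [Set.mem_insert_iff, Set.mem_singleton_iff, hb']
      tauto
    · refine ⟨hSa _ (hSb _ hx), ?_⟩
      ext z
      simp only [Set.mem_insert_iff, Set.mem_singleton_iff, ha', ← hab', hb']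
      tauto
  · intro x hx
    have h1 : a (b x) ≠ x := fun h => hfab x hx (by rw [← ha' (b x), h])
    have h2 : a (b x) ≠ a x := fun h => hfb x (a.injective h)
    rw [Set.ncard_insert_of_notMem, Set.ncard_insert_of_notMem, Set.ncard_pair]
    · exact (hfa _).symm
    · simp only [Set.mem_insert_iff, Set.mem_singleton_iff, not_or]
      exact ⟨hfab x hx, h2.symm⟩
    · simp only [Set.mem_insert_iff, Set.mem_singleton_iff, not_or]
      exact ⟨(hfa x).symm, (hfb x).symm, h1.symm⟩

end Counting

section Dihedral

variable {F : Type} {s t : Equiv.Perm F}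

theorem mul_zpow_of_involutions (hs : s * s = 1) (ht : t * t = 1) (k : ℤ) :
    t * (s * t) ^ k = (s * t) ^ (-k) * t := by
  have hs' : s⁻¹ = s := inv_eq_of_mul_eq_one_left hs
  have ht' : t⁻¹ = t := inv_eq_of_mul_eq_one_left ht
  have h : SemiconjBy t (s * t) (s * t)⁻¹ := by
    rw [SemiconjBy, mul_inv_rev, hs', ht', mul_assoc]
  have := h.zpow_right k
  rwa [SemiconjBy, inv_zpow'] at this

theorem mem_closure_pair_involutions (hs : s * s = 1) (ht : t * t = 1) {g : Equiv.Perm F}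
    (hg : g ∈ Subgroup.closure ({s, t} : Set (Equiv.Perm F))) :
    ∃ k : ℤ, g = (s * t) ^ k ∨ g = (s * t) ^ k * t := by
  have hc := mul_zpow_of_involutions hs ht
  induction hg using Subgroup.closure_induction with
  | mem x hx =>
    rcases hx with rfl | rfl
    · exact ⟨1, Or.inr (by rw [zpow_one, mul_assoc, ht, mul_one])⟩
    · exact ⟨0, Or.inr (by simp)⟩
  | one => exact ⟨0, Or.inl (by simp)⟩
  | mul a b _ _ iha ihb =>
    obtain ⟨k, rfl | rfl⟩ := iha <;> obtain ⟨l, rfl | rfl⟩ := ihb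
    · exact ⟨k + l, Or.inl (by rw [zpow_add])⟩
    · exact ⟨k + l, Or.inr (by rw [zpow_add, mul_assoc])⟩
    · exact ⟨k + -l, Or.inr (by rw [zpow_add, mul_assoc, hc, mul_assoc])⟩
    · refine ⟨k + -l, Or.inl ?_⟩
      rw [zpow_add, mul_assoc, ← mul_assoc t, hc, mul_assoc _ t t, ht, mul_one]
  | inv a _ iha =>
    obtain ⟨k, rfl | rfl⟩ := iha
    · exact ⟨-k, Or.inl (by rw [zpow_neg])⟩
    · refine ⟨k, Or.inr ?_⟩
      rw [mul_inv_rev, ← zpow_neg, inv_eq_of_mul_eq_one_left ht, hc, neg_neg]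

theorem zpow_mem_closure_pair (k : ℤ) :
    (s * t) ^ k ∈ Subgroup.closure ({s, t} : Set (Equiv.Perm F)) :=
  Subgroup.zpow_mem _ (Subgroup.mul_mem _ (Subgroup.subset_closure (by simp))
    (Subgroup.subset_closure (by simp))) k

theorem mem_orbit_closure_pair (hs : s * s = 1) (ht : t * t = 1) {x y : F} :
    y ∈ MulAction.orbit (Subgroup.closure ({s, t} : Set (Equiv.Perm F))) x ↔
      ∃ k : ℤ, y = ((s * t) ^ k) x ∨ y = ((s * t) ^ k) (t x) := by
  constructor
  · rintro ⟨⟨g, hg⟩, rfl⟩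
    obtain ⟨k, rfl | rfl⟩ := mem_closure_pair_involutions hs ht hg
    · exact ⟨k, Or.inl rfl⟩
    · exact ⟨k, Or.inr rfl⟩
  · rintro ⟨k, rfl | rfl⟩
    · exact ⟨⟨_, zpow_mem_closure_pair k⟩, rfl⟩
    · exact ⟨⟨_, Subgroup.mul_mem _ (zpow_mem_closure_pair k)
        (Subgroup.subset_closure (by simp))⟩, rfl⟩

/-- If `s` and `t` are fixed-point-free involutions then `t x` is not in the orbit of `x` under
the rotation `s * t`. -/
theorem involution_apply_ne_zpow (hs : s * s = 1) (ht : t * t = 1) (hfs : ∀ x, s x ≠ x)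
    (hft : ∀ x, t x ≠ x) (x : F) (k : ℤ) : t x ≠ ((s * t) ^ k) x := by
  intro h
  have hc : ∀ (j : ℤ) (y : F), t (((s * t) ^ j) y) = ((s * t) ^ (-j)) (t y) := fun j y =>
    Equiv.congr_fun (mul_zpow_of_involutions hs ht j) y
  have hst : ∀ y, s y = (s * t) (t y) := fun y =>
    congrArg s (Equiv.congr_fun ht y).symm
  rcases Int.even_or_odd' k with ⟨j, rfl | rfl⟩
  · apply hft (((s * t) ^ j) x)
    rw [hc, h, ← Equiv.Perm.mul_apply, ← zpow_add]
    congr 2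
    ring
  · apply hfs (((s * t) ^ (j + 1)) x)
    rw [hst, hc, h, ← Equiv.Perm.mul_apply, ← Equiv.Perm.mul_apply, ← zpow_one_add, ← zpow_add]
    congr 2
    ring

theorem card_orbit_closure_pair [Fintype F] (hs : s * s = 1) (ht : t * t = 1)
    (hfs : ∀ x, s x ≠ x) (hft : ∀ x, t x ≠ x) (x : F) :
    Nat.card (MulAction.orbit (Subgroup.closure ({s, t} : Set (Equiv.Perm F))) x) =
      2 * Function.minimalPeriod (s * t) x := by
  classical
  set O : Set F := MulAction.orbit (Subgroup.zpowers (s * t)) x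
  have hc : ∀ (j : ℤ) (y : F), t (((s * t) ^ j) y) = ((s * t) ^ (-j)) (t y) := fun j y =>
    Equiv.congr_fun (mul_zpow_of_involutions hs ht j) y
  have hmem : ∀ y, y ∈ O ↔ ∃ k : ℤ, y = ((s * t) ^ k) x := by
    intro y
    constructor
    · rintro ⟨⟨g, k, rfl⟩, rfl⟩
      exact ⟨k, rfl⟩
    · rintro ⟨k, rfl⟩
      exact ⟨⟨_, k, rfl⟩, rfl⟩
  have hunion : MulAction.orbit (Subgroup.closure ({s, t} : Set (Equiv.Perm F))) x =
      O ∪ t '' O := by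
    ext y
    rw [mem_orbit_closure_pair hs ht, exists_or, Set.mem_union, hmem, Set.mem_image]
    refine or_congr Iff.rfl ⟨?_, ?_⟩
    · rintro ⟨k, rfl⟩
      exact ⟨((s * t) ^ (-k)) x, (hmem _).2 ⟨_, rfl⟩, by rw [hc, neg_neg]⟩
    · rintro ⟨z, hz, rfl⟩
      obtain ⟨k, rfl⟩ := (hmem z).1 hz
      exact ⟨-k, hc k x⟩
  have hdisj : Disjoint O (t '' O) := by
    rw [Set.disjoint_right]
    rintro _ ⟨z, hz, rfl⟩ h
    obtain ⟨k, rfl⟩ := (hmem z).1 hz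
    obtain ⟨l, hl⟩ := (hmem _).1 h
    refine involution_apply_ne_zpow hs ht hfs hft (((s * t) ^ k) x) (l - k) ?_
    rw [hl, ← Equiv.Perm.mul_apply, ← zpow_add, sub_add_cancel]
  have hcardO : O.ncard = Function.minimalPeriod (s * t) x := by
    have := MulAction.minimalPeriod_eq_card (a := s * t) (b := x)
    rw [← Nat.card_eq_fintype_card] at this
    exact this.symm
  rw [Nat.card_coe_set_eq, hunion, Set.ncard_union_eq hdisj,
    Set.ncard_image_of_injective _ t.injective, hcardO]
  ring

theorem pow_apply_of_card_orbit [Fintype F] (hs : s * s = 1) (ht : t * t = 1)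
    (hfs : ∀ x, s x ≠ x) (hft : ∀ x, t x ≠ x) {n : ℕ}
    (h : ∀ x : F, Nat.card (MulAction.orbit
      (Subgroup.closure ({s, t} : Set (Equiv.Perm F))) x) = 2 * n) :
    (s * t) ^ n = 1 := by
  ext x
  have hx := card_orbit_closure_pair hs ht hfs hft x
  have hn : Function.minimalPeriod (s * t) x = n := by
    have := h x
    omega
  have := Function.isPeriodicPt_minimalPeriod (s * t) x
  rw [hn] at this
  rw [← Equiv.Perm.iterate_eq_pow]
  exact this

end Dihedral

namespace CMap

variable {F : Type} [Fintype F] (M : CMap F)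

theorem s0_s0 (x : F) : M.s0 (M.s0 x) = x := Equiv.congr_fun M.invol0 x

theorem s1_s1 (x : F) : M.s1 (M.s1 x) = x := Equiv.congr_fun M.invol1 x

theorem s2_s2 (x : F) : M.s2 (M.s2 x) = x := Equiv.congr_fun M.invol2 x

theorem s0_mul_s2 : M.s0 * M.s2 = M.s2 * M.s0 := by
  have h := inv_eq_of_mul_eq_one_left M.invol02
  rw [mul_inv_rev, inv_eq_of_mul_eq_one_left M.invol0, inv_eq_of_mul_eq_one_left M.invol2] at h
  exact h.symm

open Classical in
theorem card_flags_of_card_orbit (H : Subgroup (Equiv.Perm F)) {n : ℕ}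
    (h : ∀ x : F, Nat.card (MulAction.orbit H x) = n) :
    Fintype.card F = Nat.card (Set.range fun x : F => (MulAction.orbit H x : Set F)) * n := by
  rw [← Finset.card_univ, card_eq_card_blocks_mul Finset.univ
    (fun x : F => (MulAction.orbit H x : Set F)) n, Nat.card_coe_set_eq,
    ← Set.ncard_coe_finset, Finset.coe_image, Finset.coe_univ, Set.image_univ]
  · exact fun x _ => MulAction.mem_orbit_self x
  · exact fun x _ y hy => ⟨Finset.mem_univ _, MulAction.orbit_eq_iff.2 hy⟩
  · exact fun x _ => by rw [← Nat.card_coe_set_eq]; exact h x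

theorem card_edgeOf (x : F) : Nat.card (M.edgeOf x) = 4 := by
  have h := card_orbit_closure_pair M.invol0 M.invol2 M.fpf0 M.fpf2 x
  have h2 : Function.minimalPeriod (M.s0 * M.s2) x = 2 :=
    Function.minimalPeriod_eq_prime (Equiv.congr_fun M.invol02 x) (M.fpf02 x)
  rw [h2] at h
  exact h

theorem card_flags_eq_of_equivelar (heq : M.Equivelar 3 7) {p : ℕ} (hchi : M.euler = -(p : ℤ)) :
    Fintype.card F = 84 * p ∧ M.numVertices = 6 * p := by
  have hV : Fintype.card F = M.numVertices * (2 * 7) := card_flags_of_card_orbit _ heq.2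
  have hE : Fintype.card F = M.numEdges * 4 := card_flags_of_card_orbit _ M.card_edgeOf
  have hF : Fintype.card F = M.numFaces * (2 * 3) := card_flags_of_card_orbit _ heq.1
  rw [euler] at hchi
  omega

section Automorphisms

variable {M} {g : Equiv.Perm F}

theorem mul_comm_of_mem_aut (hg : g ∈ M.aut) {h : Equiv.Perm F}
    (hh : h ∈ Subgroup.closure ({M.s0, M.s1, M.s2} : Set (Equiv.Perm F))) : h * g = g * h := by
  have : g ∈ Subgroup.centralizer
      (Subgroup.closure ({M.s0, M.s1, M.s2} : Set (Equiv.Perm F)) : Set (Equiv.Perm F)) := by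
    rw [Subgroup.centralizer_closure]
    exact hg
  exact Subgroup.mem_centralizer_iff.1 this h hh

theorem eq_one_of_mem_aut (hg : g ∈ M.aut) {x : F} (hx : g x = x) : g = 1 := by
  ext y
  obtain ⟨h, hh, rfl⟩ := M.conn x y
  have := Equiv.congr_fun (mul_comm_of_mem_aut hg hh) x
  rw [Equiv.Perm.mul_apply, Equiv.Perm.mul_apply, hx] at this
  exact this.symm

theorem apply_s0_of_mem_aut (hg : g ∈ M.aut) (x : F) : g (M.s0 x) = M.s0 (g x) :=
  (Equiv.congr_fun (mul_comm_of_mem_aut hg (Subgroup.subset_closure (by simp))) x).symm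

theorem apply_s1_of_mem_aut (hg : g ∈ M.aut) (x : F) : g (M.s1 x) = M.s1 (g x) :=
  (Equiv.congr_fun (mul_comm_of_mem_aut hg (Subgroup.subset_closure (by simp))) x).symm

theorem apply_s2_of_mem_aut (hg : g ∈ M.aut) (x : F) : g (M.s2 x) = M.s2 (g x) :=
  (Equiv.congr_fun (mul_comm_of_mem_aut hg (Subgroup.subset_closure (by simp))) x).symm

theorem apply_rotation_of_mem_aut (hg : g ∈ M.aut) (k : ℤ) (x : F) :
    g (((M.s1 * M.s2) ^ k) x) = ((M.s1 * M.s2) ^ k) (g x) := by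
  refine (Equiv.congr_fun (mul_comm_of_mem_aut hg ?_) x).symm
  exact Subgroup.closure_mono (by simp) (zpow_mem_closure_pair k)

theorem mem_vertexOf {x y : F} : y ∈ M.vertexOf x ↔
    ∃ k : ℤ, y = ((M.s1 * M.s2) ^ k) x ∨ y = ((M.s1 * M.s2) ^ k) (M.s2 x) :=
  mem_orbit_closure_pair M.invol1 M.invol2

theorem vertexOf_eq_iff {x y : F} : M.vertexOf y = M.vertexOf x ↔ y ∈ M.vertexOf x :=
  MulAction.orbit_eq_iff

theorem vertexOf_s2 (x : F) : M.vertexOf (M.s2 x) = M.vertexOf x :=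
  vertexOf_eq_iff.2 (mem_vertexOf.2 ⟨0, Or.inr (by simp)⟩)

theorem vertexOf_s1 (x : F) : M.vertexOf (M.s1 x) = M.vertexOf x :=
  vertexOf_eq_iff.2 (mem_vertexOf.2 ⟨1, Or.inr (by simp [s2_s2])⟩)

open Pointwise in
theorem smul_vertexOf (hg : g ∈ M.aut) (x : F) : g • M.vertexOf x = M.vertexOf (g x) := by
  ext y
  rw [Set.mem_smul_set, mem_vertexOf]
  constructor
  · rintro ⟨z, hz, rfl⟩
    obtain ⟨k, rfl | rfl⟩ := mem_vertexOf.1 hz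
    · exact ⟨k, Or.inl (apply_rotation_of_mem_aut hg k x)⟩
    · refine ⟨k, Or.inr ?_⟩
      rw [← apply_s2_of_mem_aut hg]
      exact apply_rotation_of_mem_aut hg k _
  · rintro ⟨k, rfl | rfl⟩
    · exact ⟨_, mem_vertexOf.2 ⟨k, Or.inl rfl⟩, apply_rotation_of_mem_aut hg k x⟩
    · refine ⟨_, mem_vertexOf.2 ⟨k, Or.inr rfl⟩, ?_⟩
      rw [← apply_s2_of_mem_aut hg]
      exact apply_rotation_of_mem_aut hg k _

open Pointwise in
theorem numVertices_dvd_card_aut (hvt : M.VertexTransitive) :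
    M.numVertices ∣ Nat.card M.aut := by
  obtain ⟨x⟩ := M.nonempty
  have h : Set.range M.vertexOf = MulAction.orbit M.aut (M.vertexOf x) := by
    ext v
    constructor
    · rintro ⟨y, rfl⟩
      obtain ⟨g, hg, h⟩ := hvt x y
      exact ⟨⟨g, hg⟩, (smul_vertexOf hg x).trans h⟩
    · rintro ⟨⟨g, hg⟩, rfl⟩
      exact ⟨g x, (smul_vertexOf hg x).symm⟩
  rw [numVertices, h, Nat.card_coe_set_eq, ← MulAction.index_stabilizer]
  exact Subgroup.index_dvd_card _

theorem exists_involution_mem_aut (h : 2 ∣ Nat.card M.aut) :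
    ∃ τ ∈ M.aut, τ * τ = 1 ∧ ∀ x, τ x ≠ x := by
  have : Fact (Nat.Prime 2) := ⟨Nat.prime_two⟩
  obtain ⟨⟨τ, hτ⟩, ho⟩ := exists_prime_orderOf_dvd_card' 2 h
  have ho' : orderOf τ = 2 := by rwa [Subgroup.orderOf_mk] at ho
  refine ⟨τ, hτ, ?_, fun x hx => ?_⟩
  · rw [← sq, ← ho', pow_orderOf_eq_one]
  · rw [eq_one_of_mem_aut hτ hx, orderOf_one] at ho'
    omega

/-- An automorphism moving every vertex and of order two admits a set of vertices meeting each of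
its orbits exactly once. -/
theorem exists_bicoloring (hg : g ∈ M.aut) (hgg : g * g = 1)
    (hv : ∀ x, g x ∉ M.vertexOf x) :
    ∃ A : F → Prop, (∀ x, A (M.s1 x) ↔ A x) ∧ (∀ x, A (M.s2 x) ↔ A x) ∧
      ∀ x, A (g x) ↔ ¬ A x := by
  have hgg' : ∀ x, g (g x) = x := fun x => Equiv.congr_fun hgg x
  refine ⟨fun x => WellOrderingRel (M.vertexOf x) (M.vertexOf (g x)), ?_, ?_, ?_⟩
  · intro x
    beta_reduce
    rw [apply_s1_of_mem_aut hg, vertexOf_s1, vertexOf_s1]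
  · intro x
    beta_reduce
    rw [apply_s2_of_mem_aut hg, vertexOf_s2, vertexOf_s2]
  · intro x
    beta_reduce
    rw [hgg']
    constructor
    · exact fun h => asymm h
    · intro h
      rcases trichotomous_of WellOrderingRel (M.vertexOf x) (M.vertexOf (g x)) with h' | h' | h'
      · exact absurd h' h
      · exact absurd (vertexOf_eq_iff.1 h'.symm) (hv x)
      · exact h'

/-- In a map with triangular faces whose number of flags is `4` modulo `8`, every
automorphism of order two stabilises some vertex. -/
theorem exists_apply_mem_vertexOf (hbraid : ∀ x, M.s0 (M.s1 (M.s0 x)) = M.s1 (M.s0 (M.s1 x)))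
    (hcard : Fintype.card F % 8 = 4) (hg : g ∈ M.aut) (hgg : g * g = 1)
    (hfg : ∀ x, g x ≠ x) : ∃ x, g x ∈ M.vertexOf x := by
  classical
  by_contra! hv
  obtain ⟨A, hA1, hA2, hAg⟩ := exists_bicoloring hg hgg hv
  have h02 : ∀ x, M.s0 (M.s2 x) = M.s2 (M.s0 x) := fun x => Equiv.congr_fun M.s0_mul_s2 x
  have hgg' : ∀ x, g (g x) = x := fun x => Equiv.congr_fun hgg x
  let U : Finset F := Finset.univ.filter fun x => A x
  let B : Finset F := Finset.univ.filter fun x => A x ∧ ¬ A (M.s0 x)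
  let I : Finset F := Finset.univ.filter fun x => A x ∧ A (M.s0 x)
  let C : Finset F := Finset.univ.filter fun x => ¬ (A x ↔ A (M.s0 x))
  let D : Finset F := Finset.univ.filter fun x =>
    ¬ (A x ↔ A (M.s0 x)) ∧ ¬ (A (M.s1 x) ↔ A (M.s0 (M.s1 x)))
  have hU : Fintype.card F = 2 * U.card := by
    have h1 : (Finset.univ.filter fun x => ¬ A x) = U.map g.toEmbedding := by
      ext x
      simp only [Finset.mem_filter, Finset.mem_univ, true_and, Finset.mem_map_equiv, U]
      rw [← hAg, show g.symm x = g x from by rw [Equiv.symm_apply_eq, hgg']]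
    have h2 : U.card + (Finset.univ.filter fun x => ¬ A x).card = (Finset.univ : Finset F).card :=
      Finset.card_filter_add_card_filter_not _
    rw [h1, Finset.card_map, Finset.card_univ] at h2
    omega
  have hUBI : U.card = B.card + I.card := by
    rw [← Finset.card_union_of_disjoint]
    · congr 1
      ext x
      simp only [Finset.mem_filter, Finset.mem_univ, true_and, Finset.mem_union, U, B, I]
      tauto
    · rw [Finset.disjoint_left]
      intro x
      simp only [Finset.mem_filter, Finset.mem_univ, true_and, B, I]
      tauto
  have hI : 4 ∣ I.card := by
    refine four_dvd_card_of_free I M.s0 M.s2 M.invol0 M.invol2 M.s0_mul_s2 ?_ ?_ M.fpf0 M.fpf2 ?_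
    · intro x
      simp only [Finset.mem_filter, Finset.mem_univ, true_and, I, s0_s0]
      tauto
    · intro x
      simp only [Finset.mem_filter, Finset.mem_univ, true_and, I, h02, hA2]
      tauto
    · intro x _ h
      exact M.fpf02 x (by rw [← h, s0_s0])
  have hC : C.card = 2 * B.card := by
    have : C = B ∪ B.map M.s0.toEmbedding := by
      ext x
      simp only [Finset.mem_filter, Finset.mem_univ, true_and, Finset.mem_union,
        Finset.mem_map_equiv, B, C]
      rw [show M.s0.symm x = M.s0 x from by rw [Equiv.symm_apply_eq, s0_s0], s0_s0]
      tauto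
    rw [this, Finset.card_union_of_disjoint, Finset.card_map, two_mul]
    rw [Finset.disjoint_left]
    intro x
    simp only [Finset.mem_filter, Finset.mem_univ, true_and, Finset.mem_map_equiv, B]
    rw [show M.s0.symm x = M.s0 x from by rw [Equiv.symm_apply_eq, s0_s0]]
    tauto
  have hthird : ∀ x, A (M.s0 (M.s1 (M.s0 x))) ↔ A (M.s0 (M.s1 x)) := fun x => by
    rw [hbraid, hA1]
  have hD : C.card = 2 * D.card := by
    have : C = D ∪ D.map M.s0.toEmbedding := by
      ext x
      simp only [Finset.mem_filter, Finset.mem_univ, true_and, Finset.mem_union,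
        Finset.mem_map_equiv, D, C]
      rw [show M.s0.symm x = M.s0 x from by rw [Equiv.symm_apply_eq, s0_s0], s0_s0, hA1, hA1,
        hthird]
      tauto
    rw [this, Finset.card_union_of_disjoint, Finset.card_map, two_mul]
    rw [Finset.disjoint_left]
    intro x
    simp only [Finset.mem_filter, Finset.mem_univ, true_and, Finset.mem_map_equiv, D]
    rw [show M.s0.symm x = M.s0 x from by rw [Equiv.symm_apply_eq, s0_s0], s0_s0, hA1, hA1,
      hthird]
    tauto
  have hD4 : 4 ∣ D.card := by
    refine four_dvd_card_of_free D M.s1 g M.invol1 hgg ?_ ?_ ?_ M.fpf1 hfg ?_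
    · exact mul_comm_of_mem_aut hg (Subgroup.subset_closure (by simp))
    · intro x
      simp only [Finset.mem_filter, Finset.mem_univ, true_and, D, s1_s1]
      tauto
    · intro x
      simp only [Finset.mem_filter, Finset.mem_univ, true_and, D]
      rw [← apply_s0_of_mem_aut hg, ← apply_s1_of_mem_aut hg, ← apply_s0_of_mem_aut hg]
      simp only [hAg]
      tauto
    · intro x _ h
      exact hv x (vertexOf_eq_iff.1 (h ▸ vertexOf_s1 x))
  omega

/-- An automorphism of order two stabilising a vertex of degree seven acts as a reflection
there. -/
theorem exists_apply_eq_s2 (hrot : (M.s1 * M.s2) ^ 7 = 1) (hg : g ∈ M.aut) (hgg : g * g = 1)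
    (hfg : ∀ x, g x ≠ x) {x : F} (hx : g x ∈ M.vertexOf x) : ∃ y, g y = M.s2 y := by
  have hgg' : g (g x) = x := Equiv.congr_fun hgg x
  have hperiod : ∀ k m : ℤ, k % 7 = m % 7 → (M.s1 * M.s2) ^ k = (M.s1 * M.s2) ^ m := by
    intro k m hkm
    obtain ⟨c, hc⟩ : (7 : ℤ) ∣ k - m := Int.ModEq.dvd hkm.symm
    rw [show k = 7 * c + m by omega, zpow_add, zpow_mul,
      show (M.s1 * M.s2) ^ (7 : ℤ) = 1 from by exact_mod_cast hrot, one_zpow, one_mul]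
  have hc : ∀ (j : ℤ) (y : F), M.s2 (((M.s1 * M.s2) ^ j) y) =
      ((M.s1 * M.s2) ^ (-j)) (M.s2 y) := fun j y =>
    Equiv.congr_fun (mul_zpow_of_involutions M.invol1 M.invol2 j) y
  obtain ⟨k, hk | hk⟩ := mem_vertexOf.1 hx
  · exfalso
    have h2 : ((M.s1 * M.s2) ^ (k + k)) x = x := by
      rw [zpow_add, Equiv.Perm.mul_apply, ← hk, ← apply_rotation_of_mem_aut hg, ← hk, hgg']
    have h8 : (((M.s1 * M.s2) ^ (k + k)) ^ (4 : ℤ)) x = x :=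
      Equiv.Perm.zpow_apply_eq_self_of_apply_eq_self h2 4
    rw [← zpow_mul] at h8
    rw [hperiod _ k (by omega), ← hk] at h8
    exact hfg x h8
  · refine ⟨((M.s1 * M.s2) ^ (3 * k)) x, ?_⟩
    rw [apply_rotation_of_mem_aut hg, hk, hc, ← Equiv.Perm.mul_apply, ← zpow_add,
      hperiod (3 * k + k) (-(3 * k)) (by omega)]

end Automorphisms

end CMap

/-- There is no involution of `ℤ/7` satisfying the relations of a triangle group together with
the reflections `k ↦ -k` and `k ↦ 1 - k`. -/
theorem not_exists_reflection_zmod_seven (f : ZMod 7 → ZMod 7) (hf : ∀ k, f (f k) = k)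
    (hneg : ∀ k, f (-k) = -f k) (hbraid : ∀ k, f (1 - f k) = 1 - f (1 - k)) : False := by
  have h0 : f 0 = 0 := by
    have h := hneg 0
    rw [neg_zero] at h
    revert h
    generalize f 0 = a
    revert a
    decide
  have h1 : f 1 = 4 := by
    have h := hbraid 0
    rw [h0, sub_zero] at h
    revert h
    generalize f 1 = a
    revert a
    decide
  have h2 := hbraid 2
  rw [show (1 - 2 : ZMod 7) = -1 by decide, hneg, h1, show (1 - -4 : ZMod 7) = -2 by decide] at h2
  have h3 := hf (1 - f 2)
  rw [h2, hneg] at h3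
  have h4 : (1 : ZMod 7) = 0 := by linear_combination -h3
  exact absurd h4 (by decide)

namespace CMap

variable {F : Type} [Fintype F] {M : CMap F}

theorem isRegular_of_forall_mem_flagOrbit (y : F) (h : ∀ x, x ∈ M.flagOrbit y) :
    M.IsRegular := by
  have : Set.range M.flagOrbit = {M.flagOrbit y} := by
    ext v
    constructor
    · rintro ⟨x, rfl⟩
      exact MulAction.orbit_eq_iff.2 (h x)
    · rintro rfl
      exact ⟨y, rfl⟩
  rw [IsRegular, IsKOrbit, numFlagOrbits, this, Nat.card_coe_set_eq, Set.ncard_singleton]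

theorem flagOrbit_eq_iff {x y : F} :
    M.flagOrbit x = M.flagOrbit y ↔ ∃ g ∈ M.aut, g y = x := by
  rw [flagOrbit, flagOrbit, MulAction.orbit_eq_iff]
  constructor
  · rintro ⟨⟨g, hg⟩, h⟩
    exact ⟨g, hg, h⟩
  · rintro ⟨g, hg, h⟩
    exact ⟨⟨g, hg⟩, h⟩

/-- A vertex-transitive map of type `{3, 7}` with a vertex stabiliser containing a reflection is
regular. -/
theorem isRegular_of_reflection
    (hbraid : ∀ x, M.s0 (M.s1 (M.s0 x)) = M.s1 (M.s0 (M.s1 x)))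
    (hrot : (M.s1 * M.s2) ^ 7 = 1) (hvt : M.VertexTransitive) {g : Equiv.Perm F}
    (hg : g ∈ M.aut) {y : F} (hy : g y = M.s2 y) : M.IsRegular := by
  have hc : ∀ (j : ℤ) (z : F), M.s2 (((M.s1 * M.s2) ^ j) z) =
      ((M.s1 * M.s2) ^ (-j)) (M.s2 z) := fun j z =>
    Equiv.congr_fun (mul_zpow_of_involutions M.invol1 M.invol2 j) z
  have h02 : ∀ x, M.s0 (M.s2 x) = M.s2 (M.s0 x) := fun x => Equiv.congr_fun M.s0_mul_s2 x
  have e0 : ∀ {a b}, M.flagOrbit a = M.flagOrbit b →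
      M.flagOrbit (M.s0 a) = M.flagOrbit (M.s0 b) := by
    intro a b h
    obtain ⟨c, hc, rfl⟩ := flagOrbit_eq_iff.1 h
    exact flagOrbit_eq_iff.2 ⟨c, hc, apply_s0_of_mem_aut hc b⟩
  have e1 : ∀ {a b}, M.flagOrbit a = M.flagOrbit b →
      M.flagOrbit (M.s1 a) = M.flagOrbit (M.s1 b) := by
    intro a b h
    obtain ⟨c, hc, rfl⟩ := flagOrbit_eq_iff.1 h
    exact flagOrbit_eq_iff.2 ⟨c, hc, apply_s1_of_mem_aut hc b⟩
  have e2 : ∀ {a b}, M.flagOrbit a = M.flagOrbit b →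
      M.flagOrbit (M.s2 a) = M.flagOrbit (M.s2 b) := by
    intro a b h
    obtain ⟨c, hc, rfl⟩ := flagOrbit_eq_iff.1 h
    exact flagOrbit_eq_iff.2 ⟨c, hc, apply_s2_of_mem_aut hc b⟩
  have er : ∀ (k : ℤ) {a b}, M.flagOrbit a = M.flagOrbit b →
      M.flagOrbit (((M.s1 * M.s2) ^ k) a) = M.flagOrbit (((M.s1 * M.s2) ^ k) b) := by
    intro k a b h
    obtain ⟨c, hc, rfl⟩ := flagOrbit_eq_iff.1 h
    exact flagOrbit_eq_iff.2 ⟨c, hc, apply_rotation_of_mem_aut hc k b⟩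
  let q : ZMod 7 → F := fun k => ((M.s1 * M.s2) ^ (k.val : ℤ)) y
  have hperiod : ∀ k : ℤ, ((M.s1 * M.s2) ^ k) y = q k := by
    intro k
    simp only [q]
    rw [ZMod.val_intCast]
    conv_lhs => rw [← Int.emod_add_mul_ediv k 7]
    rw [zpow_add, zpow_mul, show (M.s1 * M.s2) ^ (7 : ℤ) = 1 from by exact_mod_cast hrot,
      one_zpow, mul_one]
    rfl
  have hq : ∀ k : ZMod 7, ∃ n : ℤ, (n : ZMod 7) = k := ZMod.intCast_surjective
  have hs2y : M.flagOrbit (M.s2 y) = M.flagOrbit y := flagOrbit_eq_iff.2 ⟨g, hg, hy⟩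
  have q2 : ∀ k, M.flagOrbit (M.s2 (q k)) = M.flagOrbit (q (-k)) := by
    intro k
    obtain ⟨n, rfl⟩ := hq k
    rw [← Int.cast_neg, ← hperiod, ← hperiod, hc]
    exact er _ hs2y
  have q1 : ∀ k, M.flagOrbit (M.s1 (q k)) = M.flagOrbit (q (1 - k)) := by
    intro k
    obtain ⟨n, rfl⟩ := hq k
    have : M.s1 (q n) = ((M.s1 * M.s2) ^ (1 - n)) (M.s2 y) := by
      rw [sub_eq_add_neg, zpow_add, Equiv.Perm.mul_apply, ← hc, zpow_one, Equiv.Perm.mul_apply,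
        s2_s2, hperiod]
    rw [this, show (1 - (n : ZMod 7)) = ((1 - n : ℤ) : ZMod 7) by push_cast; rfl, ← hperiod]
    exact er _ hs2y
  have hsurj : ∀ z, ∃ k, M.flagOrbit (q k) = M.flagOrbit z := by
    intro z
    obtain ⟨a, ha, haz⟩ := hvt z y
    have hz : M.flagOrbit (a z) = M.flagOrbit z := flagOrbit_eq_iff.2 ⟨a, ha, rfl⟩
    obtain ⟨k, hk | hk⟩ := mem_vertexOf.1 (vertexOf_eq_iff.1 haz)
    · exact ⟨k, by rw [← hz, hk, hperiod]⟩
    · refine ⟨k, ?_⟩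
      rw [← hz, hk, ← hperiod]
      exact (er _ hs2y).symm
  by_cases hinj : ∀ k l, M.flagOrbit (q k) = M.flagOrbit (q l) → k = l
  · exfalso
    choose f hf using fun k => hsurj (M.s0 (q k))
    refine not_exists_reflection_zmod_seven f ?_ ?_ ?_
    · intro k
      apply hinj
      rw [hf, e0 (hf k), s0_s0]
    · intro k
      apply hinj
      rw [hf, ← q2, ← e0 (q2 k), h02]
      exact e2 (hf k).symm
    · intro k
      apply hinj
      rw [hf, ← e0 (q1 (f k)), e0 (e1 (hf k)), hbraid, ← q1, e1 (hf (1 - k)), e1 (e0 (q1 k))]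
  · push Not at hinj
    obtain ⟨k, l, hkl, hne⟩ := hinj
    have hshift : ∀ m k l, M.flagOrbit (q k) = M.flagOrbit (q l) →
        M.flagOrbit (q (m + k)) = M.flagOrbit (q (m + l)) := by
      intro m k l h
      obtain ⟨m, rfl⟩ := hq m
      obtain ⟨k, rfl⟩ := hq k
      obtain ⟨l, rfl⟩ := hq l
      rw [← Int.cast_add, ← Int.cast_add, ← hperiod, ← hperiod, zpow_add, zpow_add]
      rw [← hperiod, ← hperiod] at h
      exact er m h
    have hd : M.flagOrbit (q (k - l)) = M.flagOrbit (q 0) := by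
      have := hshift (-l) k l hkl
      rwa [neg_add_cancel, neg_add_eq_sub] at this
    have hmul : ∀ n : ℕ, M.flagOrbit (q (n * (k - l))) = M.flagOrbit (q 0) := by
      intro n
      induction n with
      | zero => simp
      | succ n ih =>
        rw [← hd, Nat.cast_succ, add_mul, one_mul, add_comm]
        simpa using hshift (k - l) _ _ ih
    have : Fact (Nat.Prime 7) := ⟨by norm_num⟩
    refine isRegular_of_forall_mem_flagOrbit (q 0) fun x => ?_
    obtain ⟨m, hm⟩ := hsurj x
    have := hmul (m / (k - l)).val
    rw [ZMod.natCast_val, ZMod.cast_id', id, div_mul_cancel₀ _ (sub_ne_zero.2 hne)] at this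
    exact MulAction.orbit_eq_iff.1 (hm.symm.trans this)

end CMap

/-- A vertex-transitive equivelar map of Schläfli type `{3, 7}` on a
surface of Euler characteristic `-p`, `p` an odd prime, is regular. -/
theorem stmt_8 {F : Type} [Fintype F] (p : ℕ) (hp : p.Prime) (hodd : Odd p)
    (M : CMap F) (heq : M.Equivelar 3 7) (hvt : M.VertexTransitive)
    (hchi : M.euler = -(p : ℤ)) :
    M.IsRegular := by
  obtain ⟨hcard, hV⟩ := M.card_flags_eq_of_equivelar heq hchi
  have hrot : (M.s1 * M.s2) ^ 7 = 1 :=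
    pow_apply_of_card_orbit M.invol1 M.invol2 M.fpf1 M.fpf2 heq.2
  have hface : (M.s0 * M.s1) ^ 3 = 1 :=
    pow_apply_of_card_orbit M.invol0 M.invol1 M.fpf0 M.fpf1 heq.1
  have hbraid : ∀ x, M.s0 (M.s1 (M.s0 x)) = M.s1 (M.s0 (M.s1 x)) := by
    intro x
    have h := Equiv.congr_fun hface (M.s1 (M.s0 (M.s1 x)))
    simpa [pow_succ, CMap.s0_s0, CMap.s1_s1] using h
  have h2 : 2 ∣ Nat.card M.aut :=
    (Dvd.intro (3 * p) (by rw [hV]; ring)).trans (CMap.numVertices_dvd_card_aut hvt)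
  obtain ⟨τ, hτ, hττ, hfτ⟩ := CMap.exists_involution_mem_aut h2
  obtain ⟨x, hx⟩ := CMap.exists_apply_mem_vertexOf hbraid
    (by obtain ⟨k, rfl⟩ := hodd; omega) hτ hττ hfτ
  obtain ⟨y, hy⟩ := CMap.exists_apply_eq_s2 hrot hτ hττ hfτ hx
  exact CMap.isRegular_of_reflection hbraid hrot hvt hτ hy
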